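/- Let n+s be even and f ∈ WRP with sign ε and dual g, and consider the code C_{D_f} with defining set D_f = {x ∈ F_q^* : f(x) = 0}. If ε η_0(−1)^{(n+s)/2} = 1 and 0 ≤ s ≤ n−4, then C_{D_f} is a minimal linear code with parameters [p^{n−1} − 1 + (p−1)p^{(n+s−2)/2}, n, (p−1)p^{n−2}]_p. If ε η_0(−1)^{(n+s)/2} = −1 and 0 ≤ s ≤ n−6, then C_{D_f} is a minimal linear code with parameters [p^{n−1} − 1 − (p−1)p^{(n+s−2)/2}, n, (p−1)(p^{n−2} − p^{(n+s−2)/2})]_p. -/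

import Mathlib

open scoped BigOperators Classical

noncomputable section

/-- `ξ_p^j` for `j : ZMod p`, where `ξ_p = exp(2πi/p)` and the exponent `j`
is lifted to a natural number. -/
def ep (p : ℕ) (j : ZMod p) : ℂ :=
  Complex.exp (2 * Real.pi * Complex.I * (j.val : ℂ) / (p : ℂ))

/-- `√(p*)`: equal to `√p` if `p ≡ 1 (mod 4)` and to `i√p` if `p ≡ 3 (mod 4)`. -/
def sqrtPStar (p : ℕ) : ℂ :=
  if p % 4 = 1 then ((Real.sqrt p : ℝ) : ℂ) else Complex.I * ((Real.sqrt p : ℝ) : ℂ)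

/-- The quadratic character `η₀` of `F_p` (extended by `η₀(0) = 0`), with values in `ℂ`. -/
def eta0 (p : ℕ) [Fact p.Prime] (j : ZMod p) : ℂ :=
  ((quadraticChar (ZMod p) j : ℤ) : ℂ)

/-- The Walsh transform of `f : F_q → F_p`. -/
def walsh (p : ℕ) {F : Type*} [Field F] [Fintype F] [Algebra (ZMod p) F]
    (f : F → ZMod p) (β : F) : ℂ :=
  ∑ x : F, ep p (f x - Algebra.trace (ZMod p) F (β * x))

/-- `f` is weakly regular `s`-plateaued with sign `ε` and dual `g`:
`W_f(β) = ε √(p*)^{n+s} ξ_p^{g(β)}` on the Walsh support, `W_f(β) = 0` off it,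
and `g` vanishes off the Walsh support. -/
def IsWeaklyRegularPlateaued (p n s : ℕ) {F : Type*} [Field F] [Fintype F]
    [Algebra (ZMod p) F] (f : F → ZMod p) (ε : ℂ) (g : F → ZMod p) : Prop :=
  (ε = 1 ∨ ε = -1) ∧
  (∀ β : F, walsh p f β ≠ 0 →
      walsh p f β = ε * sqrtPStar p ^ (n + s) * ep p (g β)) ∧
  (∀ β : F, walsh p f β = 0 → g β = 0)

/-- `f` lies in the class `WRP`: weakly regular `s`-plateaued with sign `ε` and dual `g`,
unbalanced, `f(0) = 0`, and `f(ax) = a^h f(x)` for some positive even `h` with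
`gcd(h-1, p-1) = 1`. -/
def IsWRP (p n s : ℕ) {F : Type*} [Field F] [Fintype F]
    [Algebra (ZMod p) F] (f : F → ZMod p) (ε : ℂ) (g : F → ZMod p) : Prop :=
  IsWeaklyRegularPlateaued p n s f ε g ∧
  walsh p f 0 ≠ 0 ∧
  f 0 = 0 ∧
  ∃ h : ℕ, 0 < h ∧ Even h ∧ Nat.gcd (h - 1) (p - 1) = 1 ∧
    ∀ (a : (ZMod p)ˣ) (x : F),
      f (algebraMap (ZMod p) F (a : ZMod p) * x) = (a : ZMod p) ^ h * f x

/-- The defining set `D_f = {x ∈ F_q^* : f(x) = 0}`. -/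
def Dzero (p : ℕ) {F : Type*} [Field F] [Fintype F] [Algebra (ZMod p) F]
    (f : F → ZMod p) : Finset F :=
  Finset.univ.filter fun x => x ≠ 0 ∧ f x = 0

/-- The defining set `D_{f,sq} = {x ∈ F_q : f(x) ∈ SQ}`. -/
def Dsq (p : ℕ) {F : Type*} [Field F] [Fintype F] [Algebra (ZMod p) F]
    (f : F → ZMod p) : Finset F :=
  Finset.univ.filter fun x => f x ≠ 0 ∧ IsSquare (f x)

/-- The defining set `D_{f,nsq} = {x ∈ F_q : f(x) ∈ NSQ}`. -/
def Dnsq (p : ℕ) {F : Type*} [Field F] [Fintype F] [Algebra (ZMod p) F]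
    (f : F → ZMod p) : Finset F :=
  Finset.univ.filter fun x => f x ≠ 0 ∧ ¬ IsSquare (f x)

/-- The codeword `c_β = (Tr(βd))_{d ∈ D}` of the code `C_D`. -/
def cword (p : ℕ) {F : Type*} [Field F] [Fintype F] [Algebra (ZMod p) F]
    (D : Finset F) (β : F) : D → ZMod p :=
  fun d => Algebra.trace (ZMod p) F (β * (d : F))

/-- The Hamming weight of the codeword `c_β` of the code `C_D`. -/
def wtOn (p : ℕ) {F : Type*} [Field F] [Fintype F] [Algebra (ZMod p) F]
    (D : Finset F) (β : F) : ℕ :=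
  (D.filter fun d => Algebra.trace (ZMod p) F (β * d) ≠ 0).card

/-- `u` covers `v` : the support of `v` is contained in the support of `u`. -/
def Covers {k : ℕ} {ι : Type*} (u v : ι → ZMod k) : Prop :=
  ∀ i, v i ≠ 0 → u i ≠ 0

/-- The code `C_D` is minimal: every nonzero codeword covers only its own
nonzero scalar multiples among the nonzero codewords. -/
def IsMinimalCode (p : ℕ) {F : Type*} [Field F] [Fintype F] [Algebra (ZMod p) F]
    (D : Finset F) : Prop :=
  ∀ β : F, cword p D β ≠ 0 →
    ∀ β' : F, cword p D β' ≠ 0 → Covers (cword p D β) (cword p D β') →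
      ∃ a : ZMod p, a ≠ 0 ∧ cword p D β' = a • cword p D β

/-- The code `C_D` is an `[m, n, d]_p` code: length `m`, dimension `n`
(i.e. `β ↦ c_β` is injective, so the code has `p^n` codewords), and minimum
nonzero Hamming weight `d`. -/
def HasParams (p : ℕ) {F : Type*} [Field F] [Fintype F] [Algebra (ZMod p) F]
    (D : Finset F) (m d : ℤ) : Prop :=
  (D.card : ℤ) = m ∧
  Function.Injective (cword p D) ∧
  (∀ β : F, cword p D β ≠ 0 → d ≤ (wtOn p D β : ℤ)) ∧
  (∃ β : F, cword p D β ≠ 0 ∧ (wtOn p D β : ℤ) = d)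

theorem ep_eq_pow (p : ℕ) (j : ZMod p) :
    ep p j = Complex.exp (2 * Real.pi * Complex.I / p) ^ j.val := by
  rw [ep, ← Complex.exp_nat_mul]
  congr 1
  ring

/-- An integer combination of the `p`-th roots of unity vanishes only if its coefficients agree. -/
theorem coeff_eq_of_sum_mul_ep_eq_zero (p : ℕ) [hp : Fact p.Prime] (c : ZMod p → ℤ)
    (h : ∑ j, (c j : ℂ) * ep p j = 0) (i j : ZMod p) : c i = c j := by
  have hζ := Complex.isPrimitiveRoot_exp p hp.out.ne_zero
  have hsum : ∑ i : Fin p, (c (ZMod.finEquiv p i) : ℂ) *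
      Complex.exp (2 * Real.pi * Complex.I / p) ^ (i : ℕ) = 0 := by
    rw [← h, ← Equiv.sum_comp (ZMod.finEquiv p).toEquiv]
    refine Finset.sum_congr rfl fun i _ => ?_
    have hv : (ZMod.finEquiv p i).val = (i : ℕ) := by
      cases p with
      | zero => exact i.elim0
      | succ k => rfl
    simp only [RingEquiv.toEquiv_eq_coe, EquivLike.coe_coe, ep_eq_pow, hv]
  have := (hζ.sum_eq_zero_iff_forall_eq_int hp.out fun i => c (ZMod.finEquiv p i)).1 hsum
    ((ZMod.finEquiv p).symm i) ((ZMod.finEquiv p).symm j)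
  simpa using this

/-- Value distribution of a function whose character sum is an integer times a root of unity. -/
theorem card_fiber_of_sum_ep_eq (p : ℕ) [hp : Fact p.Prime] {ι : Type*} [Fintype ι]
    (a : ι → ZMod p) (C : ℤ) (b : ZMod p) (h : ∑ x, ep p (a x) = C * ep p b) (j : ZMod p) :
    (p : ℤ) * (Finset.univ.filter fun x => a x = j).card =
      Fintype.card ι + C * (p * (if b = j then 1 else 0) - 1) := by
  set N : ZMod p → ℤ := fun j => (Finset.univ.filter fun x => a x = j).card with hN
  have hsum : ∑ x, ep p (a x) = ∑ j, (N j : ℂ) * ep p j := by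
    rw [← Finset.sum_fiberwise (s := Finset.univ) (g := a)]
    refine Finset.sum_congr rfl fun j _ => ?_
    rw [Finset.sum_congr rfl (g := fun _ => ep p j)]
    · simp [hN]
    · intro x hx
      rw [(Finset.mem_filter.1 hx).2]
  have hconst := coeff_eq_of_sum_mul_ep_eq_zero p (fun j => N j - C * if b = j then 1 else 0) (by
    simp [sub_mul, Finset.sum_sub_distrib, ← hsum, h])
  have htot : ∑ i, N i = Fintype.card ι := by
    rw [← Finset.card_univ, Finset.card_eq_sum_card_fiberwise (f := a) (t := Finset.univ) (by simp)]
    simp [hN]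
  have h2 : ∑ i, (N i - C * if b = i then 1 else 0) =
      ∑ _i : ZMod p, (N j - C * if b = j then 1 else 0) :=
    Finset.sum_congr rfl fun i _ => hconst i j
  rw [Finset.sum_sub_distrib, htot, Finset.sum_const, Finset.card_univ, ZMod.card,
    ← Finset.mul_sum, Finset.sum_ite_eq] at h2
  simp at h2
  change (p : ℤ) * N j = _
  split_ifs at h2 ⊢ <;> linarith

theorem trace_algebraMap_mul (p : ℕ) [Fact p.Prime] {F : Type*} [Field F]
    [Algebra (ZMod p) F] (z : ZMod p) (y : F) :
    Algebra.trace (ZMod p) F (algebraMap (ZMod p) F z * y) = z * Algebra.trace (ZMod p) F y := by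
  rw [← Algebra.smul_def, map_smul, smul_eq_mul]

section

variable (p : ℕ) [Fact p.Prime] {F : Type*} [Field F] [Fintype F] [Algebra (ZMod p) F]

theorem card_trace_mul_eq (x : F) (hx : x ≠ 0) (c : ZMod p) :
    p * (Finset.univ.filter fun β : F => Algebra.trace (ZMod p) F (β * x) = c).card =
      Fintype.card F := by
  have hsurj : Function.Surjective fun β : F => Algebra.trace (ZMod p) F (β * x) :=
    (Algebra.trace_surjective (ZMod p) F).comp (mul_right_surjective₀ hx)
  let φ : F →+ ZMod p :=
    (Algebra.trace (ZMod p) F).toAddMonoidHom.comp (AddMonoidHom.mulRight x)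
  have hφ : ∀ d, (Finset.univ.filter fun β : F => φ β = d).card =
      (Finset.univ.filter fun β : F => φ β = c).card := fun d =>
    AddMonoidHom.card_fiber_eq_of_mem_range φ (hsurj d) (hsurj c)
  change p * (Finset.univ.filter fun β : F => φ β = c).card = _
  rw [← Finset.card_univ,
    Finset.card_eq_sum_card_fiberwise (s := Finset.univ) (f := φ) (t := Finset.univ) (by simp),
    Finset.sum_congr rfl fun d _ => hφ d]
  simp

/-- The number of points where `f` agrees with the linear functional `x ↦ Tr(βx)`. -/
def agreeCount (f : F → ZMod p) (β : F) : ℤ :=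
  (Finset.univ.filter fun x : F => f x = Algebra.trace (ZMod p) F (β * x)).card

variable {p}

theorem exists_mul_agreeCount_eq {n s : ℕ} {f g : F → ZMod p} {ε : ℂ}
    (hf : IsWeaklyRegularPlateaued p n s f ε g) {C : ℤ} (hC : ε * sqrtPStar p ^ (n + s) = C)
    (β : F) : ∃ t : ℤ, (t = 0 ∨ t = -1 ∨ t = p - 1) ∧
      p * agreeCount p f β = Fintype.card F + C * t := by
  by_cases hW : walsh p f β = 0
  · refine ⟨0, Or.inl rfl, ?_⟩
    have := card_fiber_of_sum_ep_eq p (fun x => f x - Algebra.trace (ZMod p) F (β * x)) 0 0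
      (by simpa [walsh] using hW) 0
    simp only [sub_eq_zero, zero_mul] at this
    simpa [agreeCount] using this
  · have := card_fiber_of_sum_ep_eq p (fun x => f x - Algebra.trace (ZMod p) F (β * x)) C (g β)
      (by rw [← hC]; exact hf.2.1 β hW) 0
    simp only [sub_eq_zero] at this
    refine ⟨p * (if g β = 0 then 1 else 0) - 1, ?_, this⟩
    split_ifs <;> simp

theorem odd_card_fiber_iff {f : F → ZMod p} (hp : p ≠ 2) (hneg : ∀ x, f (-x) = f x) (h0 : f 0 = 0)
    (j : ZMod p) : Odd (Finset.univ.filter fun x => f x = j).card ↔ j = 0 := by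
  have hF : (2 : F) ≠ 0 := by
    have : CharP F p := charP_of_injective_algebraMap (algebraMap (ZMod p) F).injective p
    exact Ring.two_ne_zero (by rwa [ringChar.eq F p])
  have key : Even ((Finset.univ.filter fun x => f x = j).erase 0).card := by
    rw [← ZMod.natCast_eq_zero_iff_even, Finset.card_eq_sum_ones, Nat.cast_sum]
    refine Finset.sum_involution (fun x _ => -x) (fun _ _ => by decide) (fun x hx _ hxx => ?_)
      (fun x hx => ?_) (fun x _ => neg_neg x)
    · refine (Finset.mem_erase.1 hx).1 ?_
      have : 2 * x = 0 := by linear_combination -hxx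
      simpa [hF] using this
    · simpa [hneg] using hx
  by_cases hj : j = 0
  · have hmem : (0 : F) ∈ Finset.univ.filter fun x => f x = j := by simp [h0, hj]
    rw [← Finset.card_erase_add_one hmem]
    simpa [hj] using key.add_one
  · have hmem : (0 : F) ∉ Finset.univ.filter fun x => f x = j := by
      simp [h0, Ne.symm hj]
    rw [Finset.erase_eq_of_notMem hmem] at key
    simpa [hj] using key

theorem dual_zero_eq_zero {n s : ℕ} {f g : F → ZMod p} {ε : ℂ} (hp : p ≠ 2)
    (hf : IsWRP p n s f ε g) {C : ℤ} (hC : ε * sqrtPStar p ^ (n + s) = C) : g 0 = 0 := by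
  obtain ⟨hpl, hW, h0, h, -, heven, -, hhom⟩ := hf
  have hneg (x : F) : f (-x) = f x := by
    simpa [heven.neg_pow] using hhom (-1) x
  have hcount := card_fiber_of_sum_ep_eq p f C (g 0) (by
    rw [← hC, ← hpl.2.1 0 hW]; simp [walsh])
  by_contra hg
  have hp2 : (2 : ZMod p) ≠ 0 := Ring.two_ne_zero (by rwa [ZMod.ringChar_zmod_n])
  have hg2 : g 0 ≠ -g 0 := fun hgg => by
    have : 2 * g 0 = 0 := by linear_combination hgg
    simp [hp2, hg] at this
  have heq := (hcount 0).trans (by simp [hg, hg2] : _ = _) |>.trans (hcount (-g 0)).symm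
  have hp0 : (p : ℤ) ≠ 0 := by exact_mod_cast (Fact.out : p.Prime).ne_zero
  have hcard := Nat.cast_injective (mul_left_cancel₀ hp0 heq)
  have h1 := (odd_card_fiber_iff hp hneg h0 0).2 rfl
  rw [hcard, odd_card_fiber_iff hp hneg h0] at h1
  exact hg (neg_eq_zero.1 h1)

theorem mul_agreeCount_zero {n s : ℕ} {f g : F → ZMod p} {ε : ℂ} (hp : p ≠ 2)
    (hf : IsWRP p n s f ε g) {C : ℤ} (hC : ε * sqrtPStar p ^ (n + s) = C) :
    p * agreeCount p f 0 = Fintype.card F + C * (p - 1) := by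
  have := card_fiber_of_sum_ep_eq p f C (g 0) (by
    rw [← hC, ← hf.1.2.1 0 hf.2.1]; simp [walsh]) 0
  simpa [agreeCount, dual_zero_eq_zero hp hf hC] using this

theorem agreeCount_algebraMap_mul {n s : ℕ} {f g : F → ZMod p} {ε : ℂ}
    (hf : IsWRP p n s f ε g) (z : (ZMod p)ˣ) (β : F) :
    agreeCount p f (algebraMap (ZMod p) F z * β) = agreeCount p f β := by
  obtain ⟨-, -, -, h, hpos, -, hgcd, hhom⟩ := hf
  have hcop : (Nat.card (ZMod p)ˣ).Coprime (h - 1) := by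
    rw [Nat.card_eq_fintype_card, ZMod.card_units]
    exact Nat.Coprime.symm hgcd
  obtain ⟨a, ha⟩ := hcop.pow_left_bijective.surjective z⁻¹
  have ha' : (a : ZMod p) ^ h = a * (z : ZMod p)⁻¹ := by
    rw [← Nat.sub_add_cancel hpos, pow_succ', ← Units.val_pow_eq_pow_val]
    simp only at ha
    rw [ha, Units.val_inv_eq_inv_val]
  have haF : algebraMap (ZMod p) F a ≠ 0 := by simp
  unfold agreeCount
  congr 1
  refine Finset.card_bij (fun x _ => algebraMap (ZMod p) F a * x) (fun x hx => ?_)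
    (fun x _ y _ hxy => mul_left_cancel₀ haF hxy) (fun y hy => ?_)
  · simp only [Finset.mem_filter, Finset.mem_univ, true_and, mul_assoc] at hx ⊢
    rw [hhom, mul_left_comm, trace_algebraMap_mul, ha', hx, trace_algebraMap_mul]
    field_simp
  · refine ⟨(algebraMap (ZMod p) F a)⁻¹ * y, ?_, by field_simp⟩
    obtain ⟨x, rfl⟩ : ∃ x, algebraMap (ZMod p) F a * x = y :=
      ⟨(algebraMap (ZMod p) F a)⁻¹ * y, by field_simp⟩
    rw [inv_mul_cancel_left₀ haF]
    simp only [Finset.mem_filter, Finset.mem_univ, true_and, mul_assoc] at hy ⊢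
    rw [hhom, mul_left_comm, trace_algebraMap_mul, ha', mul_assoc] at hy
    rw [trace_algebraMap_mul, ← mul_left_cancel₀ a.ne_zero hy]
    field_simp

theorem sum_agreeCount_line (f : F → ZMod p) (β : F) :
    ∑ z : ZMod p, agreeCount p f (algebraMap (ZMod p) F z * β) =
      p * (Finset.univ.filter fun x : F => f x = 0 ∧ Algebra.trace (ZMod p) F (β * x) = 0).card +
      (Finset.univ.filter fun x : F => Algebra.trace (ZMod p) F (β * x) ≠ 0).card := by
  simp only [agreeCount, mul_assoc, trace_algebraMap_mul, Finset.card_filter, Nat.cast_sum]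
  rw [Finset.sum_comm, Finset.mul_sum, ← Finset.sum_add_distrib]
  refine Finset.sum_congr rfl fun x _ => ?_
  by_cases hT : Algebra.trace (ZMod p) F (β * x) = 0
  · by_cases hfx : f x = 0 <;> simp [hT, hfx]
  · have (z : ZMod p) : f x = z * Algebra.trace (ZMod p) F (β * x) ↔
        f x / Algebra.trace (ZMod p) F (β * x) = z := (div_eq_iff hT).symm
    simp [hT, this]

theorem sum_agreeCount {f : F → ZMod p} (h0 : f 0 = 0) :
    p * ∑ β : F, agreeCount p f β =
      p * Fintype.card F + (Fintype.card F - 1) * Fintype.card F := by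
  have hswap : ∑ β : F, agreeCount p f β = ∑ x : F, ((Finset.univ.filter fun β : F =>
      Algebra.trace (ZMod p) F (β * x) = f x).card : ℤ) := by
    simp only [agreeCount, Finset.card_filter, Nat.cast_sum]
    rw [Finset.sum_comm]
    simp only [eq_comm]
  rw [hswap, ← Finset.add_sum_erase _ _ (Finset.mem_univ (0 : F)), mul_add, Finset.mul_sum]
  congr 1
  · simp [h0]
  · rw [Finset.sum_congr rfl (g := fun _ => (Fintype.card F : ℤ)) fun x hx => by
      exact_mod_cast card_trace_mul_eq p x (Finset.ne_of_mem_erase hx) (f x)]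
    have := Fintype.card_pos (α := F)
    simp [Finset.card_erase_of_mem, Finset.card_univ, Nat.cast_sub this]

theorem mul_card_Dzero_add_one {n s : ℕ} {f g : F → ZMod p} {ε : ℂ} (hp : p ≠ 2)
    (hf : IsWRP p n s f ε g) {C : ℤ} (hC : ε * sqrtPStar p ^ (n + s) = C) :
    (p : ℤ) * ((Dzero p f).card + 1) = Fintype.card F + C * (p - 1) := by
  rw [← mul_agreeCount_zero hp hf hC]
  have : Dzero p f = (Finset.univ.filter fun x => f x = 0).erase 0 := by
    ext x; simp [Dzero]
  have h0 : (0 : F) ∈ Finset.univ.filter fun x => f x = 0 := by simp [hf.2.2.1]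
  rw [this]
  have := Finset.card_erase_add_one h0
  simp only [agreeCount, zero_mul, map_zero]
  rw [← this]
  push_cast
  rfl

/-- The weight of `c_β` is determined by the number of points where `f` agrees with `Tr(βx)`. -/
theorem sq_mul_wtOn {n s : ℕ} {f g : F → ZMod p} {ε : ℂ} (hp : p ≠ 2)
    (hf : IsWRP p n s f ε g) {C : ℤ} (hC : ε * sqrtPStar p ^ (n + s) = C) {β : F} (hβ : β ≠ 0)
    {t : ℤ} (ht : p * agreeCount p f β = Fintype.card F + C * t) :
    (p : ℤ) ^ 2 * wtOn p (Dzero p f) β =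
      (p - 1) * (Fintype.card F + C * (p - 1 - t)) := by
  have hline := sum_agreeCount_line f β
  rw [← Finset.add_sum_erase _ _ (Finset.mem_univ (0 : ZMod p)),
    Finset.sum_congr rfl (g := fun _ => agreeCount p f β) fun z hz => by
      simpa using agreeCount_algebraMap_mul hf (Units.mk0 z (Finset.ne_of_mem_erase hz)) β] at hline
  have hcard : ((Finset.univ.erase (0 : ZMod p)).card : ℤ) = p - 1 := by
    have := (Fact.out : p.Prime).pos
    simp [Finset.card_erase_of_mem, Nat.cast_sub (Nat.succ_le_of_lt this)]
  rw [Finset.sum_const, nsmul_eq_mul, hcard, map_zero, zero_mul] at hline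
  have hzero := mul_agreeCount_zero hp hf hC
  have htr : (p : ℤ) * (Finset.univ.filter fun x : F =>
      Algebra.trace (ZMod p) F (β * x) = 0).card = Fintype.card F := by
    simp only [mul_comm β]
    exact_mod_cast card_trace_mul_eq p β hβ 0
  have hsplit : ((Finset.univ.filter fun x : F => Algebra.trace (ZMod p) F (β * x) = 0).card : ℤ) +
      (Finset.univ.filter fun x : F => Algebra.trace (ZMod p) F (β * x) ≠ 0).card =
      Fintype.card F := by
    exact_mod_cast Finset.card_filter_add_card_filter_not (s := Finset.univ)
      fun x : F => Algebra.trace (ZMod p) F (β * x) = 0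
  have hwt : ((Finset.univ.filter fun x : F =>
      f x = 0 ∧ Algebra.trace (ZMod p) F (β * x) = 0).card : ℤ) + wtOn p (Dzero p f) β =
      agreeCount p f 0 := by
    have h1 : Finset.filter (fun d => Algebra.trace (ZMod p) F (β * d) ≠ 0) (Dzero p f) =
        (Finset.univ.filter fun x => f x = 0).filter
          fun x => ¬ Algebra.trace (ZMod p) F (β * x) = 0 := by
      ext x
      simp only [Dzero, Finset.mem_filter, Finset.mem_univ, true_and]
      refine ⟨fun hx => ⟨hx.1.2, hx.2⟩, fun hx => ⟨⟨?_, hx.1⟩, hx.2⟩⟩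
      rintro rfl
      exact hx.2 (by simp)
    have h2 := Finset.card_filter_add_card_filter_not
      (s := Finset.univ.filter fun x : F => f x = 0)
      fun x : F => Algebra.trace (ZMod p) F (β * x) = 0
    rw [wtOn, h1, agreeCount, ← Finset.filter_filter]
    simp only [zero_mul, map_zero]
    exact_mod_cast h2
  linear_combination (p : ℤ) ^ 2 * hwt + p * hline + (p - 1) * hzero - (p - 1) * ht +
    p * hsplit - htr

theorem cword_ne_zero_of_wtOn_pos {D : Finset F} {β : F} (h : 0 < wtOn p D β) :
    cword p D β ≠ 0 := by
  obtain ⟨d, hd⟩ := Finset.card_pos.1 h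
  rw [Finset.mem_filter] at hd
  exact fun h0 => hd.2 (congrFun h0 ⟨d, hd.1⟩)

theorem ne_zero_of_cword_ne_zero {D : Finset F} {β : F} (h : cword p D β ≠ 0) : β ≠ 0 := by
  rintro rfl
  exact h (funext fun d => by simp [cword])

theorem cword_injective {D : Finset F} (h : ∀ β : F, β ≠ 0 → 0 < wtOn p D β) :
    Function.Injective (cword p D) := by
  intro β β' hββ
  by_contra hne
  refine cword_ne_zero_of_wtOn_pos (h _ (sub_ne_zero.2 hne)) (funext fun d => ?_)
  have := congrFun hββ d
  simp only [cword] at this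
  simp [cword, sub_mul, this]

theorem sum_wtOn_sub_of_covers {D : Finset F} {β β' : F}
    (h : Covers (cword p D β) (cword p D β')) :
    ∑ a : ZMod p, (wtOn p D (β - algebraMap (ZMod p) F a * β') : ℤ) =
      p * wtOn p D β - wtOn p D β' := by
  simp only [wtOn, sub_mul, mul_assoc, map_sub, trace_algebraMap_mul, Finset.card_filter,
    Nat.cast_sum]
  rw [Finset.sum_comm, Finset.mul_sum, ← Finset.sum_sub_distrib]
  refine Finset.sum_congr rfl fun d hd => ?_
  by_cases hT' : Algebra.trace (ZMod p) F (β' * d) = 0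
  · by_cases hT : Algebra.trace (ZMod p) F (β * d) = 0 <;> simp [hT, hT']
  · have hT : Algebra.trace (ZMod p) F (β * d) ≠ 0 := h ⟨d, hd⟩ hT'
    have (a : ZMod p) : Algebra.trace (ZMod p) F (β * d) -
        a * Algebra.trace (ZMod p) F (β' * d) ≠ 0 ↔
        ¬ Algebra.trace (ZMod p) F (β * d) / Algebra.trace (ZMod p) F (β' * d) = a := by
      rw [sub_ne_zero, Ne, div_eq_iff hT']
    have hpos := (Fact.out : p.Prime).pos
    simp only [this, ← Nat.cast_sum, ← Finset.card_filter, Finset.filter_ne]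
    simp [hT, hT', Finset.card_erase_of_mem, Nat.cast_sub (Nat.succ_le_of_lt hpos)]

/-- The Ashikhmin–Barg criterion: a code whose weights are close enough together is minimal. -/
theorem isMinimalCode_of_wtOn_bounds {D : Finset F} {wmin wmax : ℤ}
    (hmin : ∀ β : F, β ≠ 0 → wmin ≤ wtOn p D β) (hmax : ∀ β : F, β ≠ 0 → wtOn p D β ≤ wmax)
    (hratio : (p - 1) * wmax < p * wmin) : IsMinimalCode p D := by
  intro β hβ β' hβ' hcov
  have hβ0 := ne_zero_of_cword_ne_zero hβ
  have hβ'0 := ne_zero_of_cword_ne_zero hβ'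
  have hp1 : (1 : ℤ) < p := by exact_mod_cast (Fact.out : p.Prime).one_lt
  by_cases hmul : ∃ a : ZMod p, β = algebraMap (ZMod p) F a * β'
  · obtain ⟨a, rfl⟩ := hmul
    have ha : a ≠ 0 := by rintro rfl; simp at hβ0
    refine ⟨a⁻¹, inv_ne_zero ha, funext fun d => ?_⟩
    simp [cword, mul_assoc, trace_algebraMap_mul, ha]
  · exfalso
    push Not at hmul
    have hsum := sum_wtOn_sub_of_covers hcov
    rw [← Finset.add_sum_erase _ _ (Finset.mem_univ (0 : ZMod p))] at hsum
    have hlow : ((p : ℤ) - 1) * wmin ≤ ∑ a ∈ Finset.univ.erase (0 : ZMod p),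
        (wtOn p D (β - algebraMap (ZMod p) F a * β') : ℤ) := by
      have hcard : ((Finset.univ.erase (0 : ZMod p)).card : ℤ) = p - 1 := by
        have := (Fact.out : p.Prime).pos
        simp [Finset.card_erase_of_mem, Nat.cast_sub (Nat.succ_le_of_lt this)]
      rw [← hcard, ← nsmul_eq_mul]
      exact Finset.card_nsmul_le_sum _ _ _ fun a _ => hmin _ (sub_ne_zero.2 (hmul a))
    simp only [map_zero, zero_mul, sub_zero] at hsum
    nlinarith [hmin β' hβ'0, hmax β hβ0]

theorem sqrtPStar_sq (hp : p ≠ 2) : sqrtPStar p ^ 2 = eta0 p (-1) * p := by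
  have hodd : p % 2 = 1 := (Fact.out : p.Prime).eq_two_or_odd.resolve_left hp
  have hsq : ((Real.sqrt p : ℝ) : ℂ) ^ 2 = p := by
    rw [← Complex.ofReal_pow, Real.sq_sqrt (Nat.cast_nonneg p)]
    simp
  have hη : quadraticChar (ZMod p) (-1) = if p % 4 = 1 then 1 else -1 := by
    rw [quadraticChar_neg_one (by rwa [ZMod.ringChar_zmod_n]), ZMod.card,
      ZMod.χ₄_nat_eq_if_mod_four, if_neg (by omega)]
  rw [sqrtPStar, eta0, hη]
  split_ifs <;> simp [mul_pow, hsq]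

theorem mul_sqrtPStar_pow (hp : p ≠ 2) (ε : ℂ) {m : ℕ} {e : ℤ} (he : ε * eta0 p (-1) ^ m = e) :
    ε * sqrtPStar p ^ (2 * m) = (e * (p : ℤ) ^ m : ℤ) := by
  rw [pow_mul, sqrtPStar_sq hp, mul_pow, ← mul_assoc, he]
  simp

theorem exists_agreement_levels {n s : ℕ} {f g : F → ZMod p} {ε : ℂ} (hp : p ≠ 2)
    (hf : IsWRP p n s f ε g) {C : ℤ} (hC0 : C ≠ 0) (hC : ε * sqrtPStar p ^ (n + s) = C) :
    ∃ t : F → ℤ, (∀ β, t β = 0 ∨ t β = -1 ∨ t β = p - 1) ∧ t 0 = p - 1 ∧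
      (∀ β, p * agreeCount p f β = Fintype.card F + C * t β) ∧
      C * ∑ β, t β = (p - 1) * Fintype.card F := by
  choose t ht hagree using exists_mul_agreeCount_eq hf.1 hC
  refine ⟨t, ht, ?_, hagree, ?_⟩
  · have := (hagree 0).symm.trans (mul_agreeCount_zero hp hf hC)
    exact mul_left_cancel₀ hC0 (add_left_cancel this)
  · have := sum_agreeCount hf.2.2.1
    rw [Finset.mul_sum, Finset.sum_congr rfl fun β _ => hagree β, Finset.sum_add_distrib,
      ← Finset.mul_sum] at this
    simp only [Finset.sum_const, Finset.card_univ, nsmul_eq_mul] at this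
    linear_combination this

theorem exists_card_wtOn_Dzero {n s m : ℕ} {f g : F → ZMod p} {ε : ℂ} (hp : p ≠ 2)
    (hf : IsWRP p n s f ε g) (hq : Fintype.card F = p ^ n) (hm : n + s = 2 * m) (hm2 : 2 ≤ m)
    (hmn : m ≤ n) {e : ℤ} (he0 : e ≠ 0) (he : ε * eta0 p (-1) ^ m = e) :
    ((Dzero p f).card : ℤ) = p ^ (n - 1) - 1 + (p - 1) * (e * p ^ (m - 1)) ∧
    ∃ t : F → ℤ, (∀ β, t β = 0 ∨ t β = -1 ∨ t β = p - 1) ∧ t 0 = p - 1 ∧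
      (∀ β, β ≠ 0 → (wtOn p (Dzero p f) β : ℤ) =
        (p - 1) * (p ^ (n - 2) + e * p ^ (m - 2) * (p - 1 - t β))) ∧
      e * ∑ β, t β = (p - 1) * p ^ (n - m) := by
  have hp0 : (p : ℤ) ≠ 0 := by exact_mod_cast (Fact.out : p.Prime).ne_zero
  have hC := mul_sqrtPStar_pow hp ε he
  rw [← hm] at hC
  have hcard : (Fintype.card F : ℤ) = p ^ n := by exact_mod_cast hq
  obtain ⟨t, ht, ht0, hagree, hsum⟩ :=
    exists_agreement_levels hp hf (mul_ne_zero he0 (pow_ne_zero m hp0)) hC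
  have hpn1 : (p : ℤ) ^ n = p * p ^ (n - 1) := by rw [← pow_succ']; congr 1; omega
  have hpn2 : (p : ℤ) ^ n = p ^ 2 * p ^ (n - 2) := by rw [← pow_add]; congr 1; omega
  have hpm1 : (p : ℤ) ^ m = p * p ^ (m - 1) := by rw [← pow_succ']; congr 1; omega
  have hpm2 : (p : ℤ) ^ m = p ^ 2 * p ^ (m - 2) := by rw [← pow_add]; congr 1; omega
  have hpnm : (p : ℤ) ^ n = p ^ m * p ^ (n - m) := by rw [← pow_add]; congr 1; omega
  refine ⟨mul_left_cancel₀ hp0 ?_, t, ht, ht0, fun β hβ =>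
    mul_left_cancel₀ (pow_ne_zero 2 hp0) ?_, mul_left_cancel₀ (pow_ne_zero m hp0) ?_⟩
  · have := mul_card_Dzero_add_one hp hf hC
    rw [hcard] at this
    linear_combination this + hpn1 + e * (p - 1) * hpm1
  · rw [sq_mul_wtOn hp hf hC hβ (hagree β), hcard]
    linear_combination (p - 1 : ℤ) * hpn2 + (p - 1) * e * (p - 1 - t β) * hpm2
  · rw [hcard] at hsum
    linear_combination hsum + (p - 1 : ℤ) * hpnm

theorem code_Dzero_of_sign_one {n s m : ℕ} {f g : F → ZMod p} {ε : ℂ} (hp : p ≠ 2)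
    (hf : IsWRP p n s f ε g) (hq : Fintype.card F = p ^ n) (hm : n + s = 2 * m) (hm2 : 2 ≤ m)
    (hmn : m + 2 ≤ n) (he : ε * eta0 p (-1) ^ m = 1) :
    IsMinimalCode p (Dzero p f) ∧ HasParams p (Dzero p f)
      ((p : ℤ) ^ (n - 1) - 1 + (p - 1) * p ^ (m - 1)) ((p - 1) * p ^ (n - 2)) := by
  obtain ⟨hD, t, ht, ht0, hwt, hsum⟩ :=
    exists_card_wtOn_Dzero (e := 1) hp hf hq hm hm2 (by omega) one_ne_zero (by simpa using he)
  simp only [one_mul] at hD hwt hsum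
  have hp1 : (1 : ℤ) < p := by exact_mod_cast (Fact.out : p.Prime).one_lt
  have hP : (0 : ℤ) < p ^ (n - 2) := by positivity
  have hQ : (0 : ℤ) < p ^ (m - 2) := by positivity
  have hPQ : (p : ℤ) ^ 2 * p ^ (m - 2) ≤ p ^ (n - 2) := by
    rw [← pow_add]
    exact pow_le_pow_right₀ hp1.le (by omega)
  have hmin (β : F) (hβ : β ≠ 0) :
      ((p : ℤ) - 1) * p ^ (n - 2) ≤ wtOn p (Dzero p f) β := by
    rw [hwt β hβ]
    have : 0 ≤ (p : ℤ) - 1 - t β := by rcases ht β with h | h | h <;> rw [h] <;> linarith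
    exact mul_le_mul_of_nonneg_left (by nlinarith) (by linarith)
  have hmax (β : F) (hβ : β ≠ 0) :
      (wtOn p (Dzero p f) β : ℤ) ≤ (p - 1) * (p ^ (n - 2) + p ^ (m - 2) * p) := by
    rw [hwt β hβ]
    have : (p : ℤ) - 1 - t β ≤ p := by rcases ht β with h | h | h <;> rw [h] <;> linarith
    exact mul_le_mul_of_nonneg_left (by nlinarith) (by linarith)
  have hwpos : (0 : ℤ) < (p - 1) * p ^ (n - 2) := mul_pos (by linarith) hP
  have hpos (β : F) (hβ : β ≠ 0) : 0 < wtOn p (Dzero p f) β := by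
    exact_mod_cast hwpos.trans_le (hmin β hβ)
  refine ⟨isMinimalCode_of_wtOn_bounds hmin hmax ?_, hD, cword_injective hpos,
    fun β hβ => hmin β (ne_zero_of_cword_ne_zero hβ), ?_⟩
  · have h1 : ((p : ℤ) - 1) * (p ^ (n - 2) + p ^ (m - 2) * p) < p * p ^ (n - 2) := by nlinarith
    have h2 := mul_lt_mul_of_pos_left h1 (sub_pos.2 hp1)
    linarith
  · obtain ⟨β, hβ, hβt⟩ : ∃ β ≠ 0, t β = p - 1 := by
      by_contra! hcon
      have hle : ∑ β ∈ Finset.univ.erase (0 : F), t β ≤ 0 := Finset.sum_nonpos fun β hβ => by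
        rcases ht β with h | h | h
        · exact h.le
        · linarith
        · exact absurd h (hcon β (Finset.ne_of_mem_erase hβ))
      rw [← Finset.add_sum_erase _ _ (Finset.mem_univ (0 : F)), ht0] at hsum
      have : (1 : ℤ) < p ^ (n - m) := one_lt_pow₀ hp1 (by omega)
      nlinarith
    exact ⟨β, cword_ne_zero_of_wtOn_pos (hpos β hβ), by rw [hwt β hβ, hβt]; ring⟩

theorem code_Dzero_of_sign_neg_one {n s m : ℕ} {f g : F → ZMod p} {ε : ℂ} (hp : p ≠ 2)
    (hf : IsWRP p n s f ε g) (hq : Fintype.card F = p ^ n) (hm : n + s = 2 * m) (hm2 : 2 ≤ m)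
    (hmn : m + 3 ≤ n) (he : ε * eta0 p (-1) ^ m = -1) :
    IsMinimalCode p (Dzero p f) ∧ HasParams p (Dzero p f)
      ((p : ℤ) ^ (n - 1) - 1 - (p - 1) * p ^ (m - 1))
      ((p - 1) * ((p : ℤ) ^ (n - 2) - p ^ (m - 1))) := by
  obtain ⟨hD, t, ht, ht0, hwt, hsum⟩ :=
    exists_card_wtOn_Dzero (e := -1) hp hf hq hm hm2 (by omega) (by norm_num) (by simpa using he)
  have hp1 : (1 : ℤ) < p := by exact_mod_cast (Fact.out : p.Prime).one_lt
  have hQ : (0 : ℤ) < p ^ (m - 2) := by positivity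
  have hm1 : (p : ℤ) ^ (m - 1) = p * p ^ (m - 2) := by rw [← pow_succ']; congr 1; omega
  have hPQ : (p : ℤ) * (p * p ^ (m - 2)) < p ^ (n - 2) := by
    rw [← pow_succ', ← pow_succ']
    exact pow_lt_pow_right₀ hp1 (by omega)
  rw [hm1] at hD ⊢
  have hmin (β : F) (hβ : β ≠ 0) :
      ((p : ℤ) - 1) * (p ^ (n - 2) - p * p ^ (m - 2)) ≤ wtOn p (Dzero p f) β := by
    rw [hwt β hβ]
    have : (p : ℤ) - 1 - t β ≤ p := by rcases ht β with h | h | h <;> rw [h] <;> linarith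
    exact mul_le_mul_of_nonneg_left (by nlinarith) (by linarith)
  have hmax (β : F) (hβ : β ≠ 0) :
      (wtOn p (Dzero p f) β : ℤ) ≤ (p - 1) * p ^ (n - 2) := by
    rw [hwt β hβ]
    have : 0 ≤ (p : ℤ) - 1 - t β := by rcases ht β with h | h | h <;> rw [h] <;> linarith
    exact mul_le_mul_of_nonneg_left (by nlinarith) (by linarith)
  have hwpos : (0 : ℤ) < (p - 1) * (p ^ (n - 2) - p * p ^ (m - 2)) :=
    mul_pos (by linarith)
      (sub_pos.2 ((le_mul_of_one_le_left (by positivity) hp1.le).trans_lt hPQ))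
  have hpos (β : F) (hβ : β ≠ 0) : 0 < wtOn p (Dzero p f) β := by
    exact_mod_cast hwpos.trans_le (hmin β hβ)
  refine ⟨isMinimalCode_of_wtOn_bounds hmin hmax ?_, by rw [hD]; ring, cword_injective hpos,
    fun β hβ => hmin β (ne_zero_of_cword_ne_zero hβ), ?_⟩
  · have h1 : ((p : ℤ) - 1) * p ^ (n - 2) < p * (p ^ (n - 2) - p * p ^ (m - 2)) := by linarith
    have h2 := mul_lt_mul_of_pos_left h1 (sub_pos.2 hp1)
    linarith
  · obtain ⟨β, hβ⟩ : ∃ β, t β = -1 := by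
      by_contra! hcon
      have hle : 0 ≤ ∑ β, t β := Finset.sum_nonneg fun β _ => by
        rcases ht β with h | h | h
        · exact h.ge
        · exact absurd h (hcon β)
        · linarith
      have : (0 : ℤ) < p ^ (n - m) := by positivity
      nlinarith
    have hβ0 : β ≠ 0 := by
      rintro rfl
      linarith
    exact ⟨β, cword_ne_zero_of_wtOn_pos (hpos β hβ0), by rw [hwt β hβ0, hβ]; ring⟩

end

theorem statement_15 (p n s : ℕ) [Fact p.Prime] (hp : p ≠ 2) (hn : 0 < n) (hs : s ≤ n)
    {F : Type*} [Field F] [Fintype F] [Algebra (ZMod p) F]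
    (hq : Fintype.card F = p ^ n)
    (f g : F → ZMod p) (ε : ℂ)
    (hf : IsWRP p n s f ε g)
    (heven : Even (n + s)) :
    (ε * (eta0 p (-1)) ^ ((n + s) / 2) = 1 → s + 4 ≤ n →
      IsMinimalCode p (Dzero p f) ∧
      HasParams p (Dzero p f)
        ((p : ℤ) ^ (n - 1) - 1 + ((p : ℤ) - 1) * (p : ℤ) ^ ((n + s - 2) / 2))
        (((p : ℤ) - 1) * (p : ℤ) ^ (n - 2))) ∧
    (ε * (eta0 p (-1)) ^ ((n + s) / 2) = -1 → s + 6 ≤ n →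
      IsMinimalCode p (Dzero p f) ∧
      HasParams p (Dzero p f)
        ((p : ℤ) ^ (n - 1) - 1 - ((p : ℤ) - 1) * (p : ℤ) ^ ((n + s - 2) / 2))
        (((p : ℤ) - 1) * ((p : ℤ) ^ (n - 2) - (p : ℤ) ^ ((n + s - 2) / 2)))) := by
  obtain ⟨m, hm⟩ := heven.two_dvd
  have hm' : (n + s) / 2 = m := by omega
  have hm1 : (n + s - 2) / 2 = m - 1 := by omega
  rw [hm', hm1]
  exact ⟨fun he hsn => code_Dzero_of_sign_one hp hf hq hm (by omega) (by omega) he,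
    fun he hsn => code_Dzero_of_sign_neg_one hp hf hq hm (by omega) (by omega) he⟩
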